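/- arXiv:1801.09440 — 2 statements merged into one kernel-verified Lean document; each statement's English description precedes it below -/
import Mathlib

section
/- Let {P(u,·), u ∈ X} be a generalised Markov kernel on a compact metric space (X,d) and A ⊂ X a closed set with P(u, X∖A) = 0 for u ∈ A, satisfying conditions (i)-(iv) with eigenvalue λ = 1. Let μ be a Borel probability measure on X with supp μ = A and 𝔓_1^* μ = μ, and let h : X → (0,∞) be a Lipschitz-continuous function with 𝔓_1 h = h on X and ⟨h, μ⟩ = 1. Then sup over all Borel probability measures ν on X of ‖𝔓_k^* ν − ⟨h, ν⟩ μ‖_L^* converges to 0 as k → ∞. -/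
open MeasureTheory Filter Set Metric

noncomputable section

namespace GMK

variable {X : Type} [MetricSpace X] [CompactSpace X] [MeasurableSpace X] [BorelSpace X]

/-- Iterations `P_k(u, ·)` of a (generalised Markov) kernel, with `P_0(u,·) = δ_u`. -/
def iterP (P : X → Measure X) : ℕ → X → Measure X
  | 0 => fun u => Measure.dirac u
  | (n+1) => fun u => (iterP P n u).bind P

/-- The semigroup `𝔓_k f (u) = ∫ f(v) P_k(u, dv)`. -/
def PP (P : X → Measure X) (k : ℕ) (f : X → ℝ) (u : X) : ℝ := ∫ v, f v ∂(iterP P k u)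

/-- The dual semigroup `𝔓_k^* μ (Γ) = ∫ P_k(u, Γ) μ(du)`. -/
def PPstar (P : X → Measure X) (k : ℕ) (μ : Measure X) : Measure X := μ.bind (iterP P k)

/-- Support of a Borel measure. -/
def msupp (μ : Measure X) : Set X := {x | ∀ U : Set X, IsOpen U → x ∈ U → 0 < μ U}

/-- `‖f‖_X`, the sup-norm over `X`. -/
def supX (f : X → ℝ) : ℝ := sSup (Set.range fun u => |f u|)

/-- `f : X → ℝ` is Lipschitz. -/
def IsLip (f : X → ℝ) : Prop := ∃ L : ℝ, ∀ u v, |f u - f v| ≤ L * dist u v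

/-- The Lipschitz norm `‖f‖_L = ‖f‖_∞ + Lip(f)`. -/
def lipNorm (f : X → ℝ) : ℝ :=
  supX f + sInf {L | 0 ≤ L ∧ ∀ u v, |f u - f v| ≤ L * dist u v}

/-- A generalised Markov kernel: finite nonvanishing measures depending continuously
(in the weak topology) and measurably on the point. -/
def GenKernel (P : X → Measure X) : Prop :=
  (∀ u, IsFiniteMeasure (P u)) ∧ (∀ u, P u Set.univ ≠ 0) ∧
  (∀ Γ : Set X, MeasurableSet Γ → Measurable fun u => P u Γ) ∧
  (∀ f : X → ℝ, Continuous f → Continuous fun u => ∫ v, f v ∂(P u))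

/-- (i) Refined uniform Feller property. -/
def CondI (P : X → Measure X) : Prop :=
  ∀ c : ℝ, 0 < c → c < 1 → ∃ C : ℝ, 0 < C ∧
    ∀ k : ℕ, 1 ≤ k → ∀ f : X → ℝ, IsLip f → ∀ v v' : X,
      |PP P k f v - PP P k f v'| ≤
        (C * supX f + c * lipNorm f) * supX (PP P k fun _ => 1) * dist v v'

/-- (ii) Uniform irreducibility on `A`. -/
def CondII (P : X → Measure X) (A : Set X) : Prop :=
  ∀ r : ℝ, 0 < r → ∃ m : ℕ, 1 ≤ m ∧ ∃ p : ℝ, 0 < p ∧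
    ∀ u : X, ∀ uhat ∈ A, ENNReal.ofReal p ≤ iterP P m u (closedBall uhat r)

/-- (iii) Concentration near `A`:  `sup_u P_k(u, X ∖ A_r) → 0`. -/
def CondIII (P : X → Measure X) (A : Set X) : Prop :=
  ∀ r : ℝ, 0 < r → ∀ ε : ℝ, 0 < ε → ∃ N : ℕ, ∀ k ≥ N, ∀ u : X,
    iterP P k u {x | ¬ Metric.infDist x A < r} ≤ ENNReal.ofReal ε

/-- (iv) Exponential bound `sup_k λ^{-k} ‖𝔓_k 1‖_X < ∞`. -/
def CondIV (P : X → Measure X) (lam : ℝ) : Prop :=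
  ∃ Λ : ℝ, ∀ k : ℕ, 1 ≤ k → lam ^ (-(k : ℤ)) * supX (PP P k fun _ => 1) ≤ Λ

open ProbabilityTheory

omit [BorelSpace X] in
theorem GenKernel.exists_isFiniteKernel {P : X → Measure X} (hP : GenKernel P) :
    ∃ K : Kernel X X, IsFiniteKernel K ∧ ⇑K = P := by
  obtain ⟨hfin, -, hmeas, hcont⟩ := hP
  refine ⟨⟨P, Measure.measurable_of_measurable_coe _ hmeas⟩, ?_, rfl⟩
  have hc : Continuous fun u => (P u).real univ := by
    simpa using hcont (fun _ => 1) continuous_const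
  obtain ⟨B, hB⟩ := (isCompact_range hc).bddAbove
  refine ⟨ENNReal.ofReal B, ENNReal.ofReal_lt_top, fun u => ?_⟩
  have := hfin u
  have hu : (P u).real univ ≤ B := hB ⟨u, rfl⟩
  exact (ofReal_measureReal (μ := P u) (s := univ)).symm.le.trans (ENNReal.ofReal_le_ofReal hu)

omit [MetricSpace X] [CompactSpace X] [BorelSpace X] in
theorem isFiniteKernel_pow (K : Kernel X X) [IsFiniteKernel K] (n : ℕ) :
    IsFiniteKernel (K ^ n) := by
  induction n with
  | zero => exact inferInstanceAs (IsFiniteKernel (Kernel.id : Kernel X X))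
  | succ n ih => rw [pow_succ']; exact inferInstanceAs (IsFiniteKernel (K ∘ₖ (K ^ n)))

omit [MetricSpace X] [CompactSpace X] [BorelSpace X] in
theorem iterP_eq_pow (K : Kernel X X) (n : ℕ) : iterP K n = ⇑(K ^ n) := by
  induction n with
  | zero => rfl
  | succ n ih =>
    funext u
    rw [pow_succ']
    change (iterP K n u).bind K = (K ∘ₖ (K ^ n)) u
    rw [ih, Kernel.comp_apply]

theorem integrable_of_continuous {f : X → ℝ} (hf : Continuous f) (ν : Measure X)
    [IsFiniteMeasure ν] : Integrable f ν :=
  hf.integrable_of_hasCompactSupport (HasCompactSupport.of_compactSpace f)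

omit [CompactSpace X] [MeasurableSpace X] [BorelSpace X] in
theorem IsLip.continuous {f : X → ℝ} (hf : IsLip f) : Continuous f := by
  obtain ⟨L, hL⟩ := hf
  refine (LipschitzWith.of_dist_le' (K := L) fun u v => ?_).continuous
  rw [Real.dist_eq]; exact hL u v

theorem integral_PPstar (K : Kernel X X) [IsFiniteKernel K] (k : ℕ) (ν : Measure X)
    [IsFiniteMeasure ν] {f : X → ℝ} (hf : Continuous f) :
    ∫ v, f v ∂(PPstar K k ν) = ∫ u, PP K k f u ∂ν := by
  have := isFiniteKernel_pow K k
  have key : ∫ v, f v ∂((K ^ k) ∘ₖ Kernel.const Unit ν) ()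
      = ∫ u, ∫ v, f v ∂(K ^ k) u ∂(Kernel.const Unit ν ()) :=
    Kernel.integral_comp (integrable_of_continuous hf _)
  simp only [PPstar, PP, iterP_eq_pow]
  simpa [Kernel.comp_apply] using key

theorem PP_add (K : Kernel X X) [IsFiniteKernel K] (k m : ℕ) {f : X → ℝ} (hf : Continuous f)
    (u : X) : PP K (k + m) f u = ∫ v, PP K k f v ∂((K ^ m) u) := by
  have := isFiniteKernel_pow K k
  have := isFiniteKernel_pow K m
  simp only [PP, iterP_eq_pow, pow_add]
  exact Kernel.integral_comp (κ := K ^ m) (η := K ^ k) (a := u) (integrable_of_continuous hf _)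

omit [CompactSpace X] in
theorem PP_zero (K : Kernel X X) (f : X → ℝ) (hf : Continuous f) : PP K 0 f = f := by
  funext u
  exact integral_dirac' f u hf.stronglyMeasurable

theorem PP_continuous (K : Kernel X X) [IsFiniteKernel K]
    (hK : ∀ f : X → ℝ, Continuous f → Continuous fun u => ∫ v, f v ∂(K u)) (k : ℕ)
    {f : X → ℝ} (hf : Continuous f) : Continuous (PP K k f) := by
  induction k with
  | zero => rwa [PP_zero K f hf]
  | succ k ih =>
    have : PP K (k + 1) f = fun u => ∫ v, PP K k f v ∂(K u) := by
      funext u; rw [PP_add K k 1 hf, pow_one]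
    rw [this]
    exact hK _ ih

theorem PP_eq_self (K : Kernel X X) [IsFiniteKernel K] {h : X → ℝ} (hh : Continuous h)
    (heig : ∀ u, PP K 1 h u = h u) (k : ℕ) : PP K k h = h := by
  induction k with
  | zero => exact PP_zero K h hh
  | succ k ih =>
    funext u
    rw [PP_add K k 1 hh, ih, ← heig u, PP, iterP_eq_pow]

theorem integral_PP_of_stationary (K : Kernel X X) [IsFiniteKernel K]
    (hK : ∀ f : X → ℝ, Continuous f → Continuous fun u => ∫ v, f v ∂(K u)) {μ : Measure X}
    [IsFiniteMeasure μ] (hstat : PPstar K 1 μ = μ) (k : ℕ) {f : X → ℝ} (hf : Continuous f) :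
    ∫ u, PP K k f u ∂μ = ∫ u, f u ∂μ := by
  induction k with
  | zero => rw [PP_zero K f hf]
  | succ k ih =>
    rw [← ih]
    conv_rhs => rw [← hstat, integral_PPstar K 1 μ (PP_continuous K hK k hf)]
    refine integral_congr_ae (ae_of_all _ fun u => ?_)
    simp only [PP_add K k 1 hf, PP.eq_def K 1, iterP_eq_pow]

omit [BorelSpace X] in
theorem nonempty_msupp (μ : Measure X) [IsProbabilityMeasure μ] : (msupp μ).Nonempty := by
  by_contra hne
  rw [Set.not_nonempty_iff_eq_empty] at hne
  have : μ univ = 0 := by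
    refine measure_null_of_locally_null _ fun x _ => ?_
    have hx : x ∉ msupp μ := by simp [hne]
    simp only [msupp, Set.mem_ofPred_eq, not_forall, not_lt, nonpos_iff_eq_zero] at hx
    obtain ⟨U, hU, hxU, h0⟩ := hx
    exact ⟨U, mem_nhdsWithin_of_mem_nhds (hU.mem_nhds hxU), h0⟩
  simp at this

omit [MeasurableSpace X] [BorelSpace X] in
theorem abs_le_supX {f : X → ℝ} (hf : Continuous f) (u : X) : |f u| ≤ supX f :=
  le_csSup (isCompact_range hf.abs).bddAbove ⟨u, rfl⟩

omit [MetricSpace X] [CompactSpace X] [MeasurableSpace X] [BorelSpace X] in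
theorem supX_nonneg (f : X → ℝ) : 0 ≤ supX f :=
  Real.sSup_nonneg (by rintro _ ⟨u, rfl⟩; exact abs_nonneg _)

omit [CompactSpace X] [MeasurableSpace X] [BorelSpace X] in
theorem supX_le_lipNorm (f : X → ℝ) : supX f ≤ lipNorm f :=
  le_add_of_nonneg_right (Real.sInf_nonneg fun _ hL => hL.1)

omit [CompactSpace X] [BorelSpace X] in
/-- Under (i) and (iv), the iterates of the Lipschitz unit ball are uniformly Lipschitz. -/
theorem exists_uniform_lipschitz {P : X → Measure X} (hi : CondI P) (hiv : CondIV P 1) :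
    ∃ L : ℝ, 0 ≤ L ∧ ∀ k : ℕ, 1 ≤ k → ∀ f : X → ℝ, IsLip f → lipNorm f ≤ 1 →
      ∀ v v' : X, |PP P k f v - PP P k f v'| ≤ L * dist v v' := by
  obtain ⟨C, hC, hF⟩ := hi (1 / 2) (by norm_num) (by norm_num)
  obtain ⟨Λ, hΛ⟩ := hiv
  have hΛ' : ∀ k : ℕ, 1 ≤ k → supX (PP P k fun _ => 1) ≤ Λ := fun k hk => by
    simpa using hΛ k hk
  have hΛ0 : 0 ≤ Λ := (supX_nonneg _).trans (hΛ' 1 le_rfl)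
  refine ⟨(C + 1 / 2) * Λ, by positivity, fun k hk f hf hf1 v v' => ?_⟩
  have hs : supX f ≤ 1 := (supX_le_lipNorm f).trans hf1
  refine (hF k hk f hf v v').trans ?_
  gcongr
  · exact supX_nonneg _
  · nlinarith
  · linarith
  · exact hΛ' k hk

/-- A nonnegative Lipschitz function has integral bounded below by the mass of a ball times its
approximate value at the centre. -/
theorem mul_max_le_integral {φ : X → ℝ} (hφ : Continuous φ) (h0 : ∀ x, 0 ≤ φ x) {L : ℝ}
    (hL0 : 0 ≤ L) (hL : ∀ x y, |φ x - φ y| ≤ L * dist x y) {ν : Measure X} [IsFiniteMeasure ν]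
    {p r : ℝ} {x : X} (hp : p ≤ ν.real (closedBall x r)) :
    p * max 0 (φ x - L * r) ≤ ∫ y, φ y ∂ν := by
  have hint := integrable_of_continuous hφ ν
  calc p * max 0 (φ x - L * r) ≤ max 0 (φ x - L * r) * ν.real (closedBall x r) := by
        rw [mul_comm]; gcongr
    _ ≤ ∫ y in closedBall x r, φ y ∂ν := by
        refine setIntegral_ge_of_const_le_real isClosed_closedBall.measurableSet
          (measure_ne_top _ _) (fun y hy => max_le (h0 y) ?_) hint.integrableOn
        have h1 := (abs_le.1 (hL y x)).1
        have h2 : L * dist y x ≤ L * r := mul_le_mul_of_nonneg_left hy hL0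
        linarith
    _ ≤ ∫ y, φ y ∂ν := setIntegral_le_integral hint (ae_of_all _ h0)

/-- `g` is trapped between two multiples of `h` whose coefficients are at most `M` in absolute value
and differ by at most `δ`. -/
def Trapped (h : X → ℝ) (M δ : ℝ) (g : X → ℝ) : Prop :=
  ∃ a b : ℝ, b - a ≤ δ ∧ -M ≤ a ∧ b ≤ M ∧ ∀ u, a * h u ≤ g u ∧ g u ≤ b * h u

theorem Trapped.integral {h g : X → ℝ} {M δ : ℝ} (hg : Trapped h M δ g) (hh : Continuous h)
    (hgc : Continuous g) {ν : Measure X} [IsFiniteMeasure ν] (hν : ∫ u, h u ∂ν = 1) {c H : ℝ}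
    (hc : ∫ u, g u ∂ν = c) (hδ : 0 ≤ δ) (hpos : ∀ u, 0 < h u) (hH : ∀ u, h u ≤ H)
    {ρ : Measure X} [IsProbabilityMeasure ρ] :
    |∫ u, g u ∂ρ - (∫ u, h u ∂ρ) * c| ≤ δ * H := by
  obtain ⟨a, b, hab, -, -, hu⟩ := hg
  have lower (τ : Measure X) [IsFiniteMeasure τ] : a * ∫ u, h u ∂τ ≤ ∫ u, g u ∂τ := by
    rw [← integral_const_mul]
    exact integral_mono ((integrable_of_continuous hh τ).const_mul a)
      (integrable_of_continuous hgc τ) fun u => (hu u).1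
  have upper (τ : Measure X) [IsFiniteMeasure τ] : ∫ u, g u ∂τ ≤ b * ∫ u, h u ∂τ := by
    rw [← integral_const_mul]
    exact integral_mono (integrable_of_continuous hgc τ)
      ((integrable_of_continuous hh τ).const_mul b) fun u => (hu u).2
  have l1 := lower ν
  have u1 := upper ν
  rw [hν, hc, mul_one] at l1 u1
  have l2 := lower ρ
  have u2 := upper ρ
  have hI : ∫ u, h u ∂ρ ≤ H := by
    simpa using integral_mono (integrable_of_continuous hh ρ) (integrable_const H) hH
  have hI0 : 0 ≤ ∫ u, h u ∂ρ := integral_nonneg fun u => (hpos u).le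
  set I := ∫ u, h u ∂ρ
  have hδI : δ * I ≤ δ * H := mul_le_mul_of_nonneg_left hI hδ
  rw [abs_le]
  constructor <;> nlinarith

/-- Integrating against a kernel that fixes `h` and charges a fixed ball uniformly contracts the
width of the trap, up to an error of the order of the radius. -/
theorem Trapped.contract {K : Kernel X X} [IsFiniteKernel K] {h g : X → ℝ} {M δ : ℝ}
    (hg : Trapped h M δ g) (hgc : Continuous g) (hh : Continuous h) (hpos : ∀ u, 0 < h u) {H : ℝ}
    (hH : ∀ u, h u ≤ H) (hK : ∀ u, ∫ v, h v ∂(K u) = h u) {L Lh : ℝ} (hL0 : 0 ≤ L)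
    (hLh0 : 0 ≤ Lh) (hM : 0 ≤ M) (hL : ∀ x y, |g x - g y| ≤ L * dist x y)
    (hLh : ∀ x y, |h x - h y| ≤ Lh * dist x y) {p r : ℝ} (hp0 : 0 < p) (hp1 : p ≤ 1)
    {x : X} (hp : ∀ u, p ≤ (K u).real (closedBall x r)) :
    Trapped h M ((1 - p * h x / H) * δ + 2 * (p / H) * ((M * Lh + L) * r))
      (fun u => ∫ v, g v ∂(K u)) := by
  obtain ⟨a, b, hab, ha, hb, hu⟩ := hg
  have hH0 : 0 < H := (hpos x).trans_le (hH x)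
  have hab0 : a ≤ b := le_of_mul_le_mul_right ((hu x).1.trans (hu x).2) (hpos x)
  have hLip : 0 ≤ M * Lh + L := by positivity
  have int_h (u : X) := integrable_of_continuous hh (K u)
  have int_g (u : X) := integrable_of_continuous hgc (K u)
  have lip {c : ℝ} (hc : |c| ≤ M) (y z : X) :
      |c * (h y - h z)| ≤ M * Lh * dist y z := by
    rw [abs_mul, mul_assoc]
    exact mul_le_mul hc (hLh y z) (abs_nonneg _) hM
  set s := max 0 (g x - a * h x - (M * Lh + L) * r)
  set t := max 0 (b * h x - g x - (M * Lh + L) * r)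
  have lower (u : X) : p * s ≤ ∫ v, g v ∂(K u) - a * h u := by
    have := mul_max_le_integral (φ := fun v => g v - a * h v) (hgc.sub (hh.const_mul a))
      (fun v => sub_nonneg.2 (hu v).1) hLip (fun y z => ?_) (hp u)
    · rwa [integral_sub (int_g u) ((int_h u).const_mul a), integral_const_mul, hK] at this
    · have h1 := abs_le.1 (lip (abs_le.2 ⟨ha, hab0.trans hb⟩) y z)
      have h2 := abs_le.1 (hL y z)
      rw [abs_le]
      constructor <;> nlinarith
  have upper (u : X) : p * t ≤ b * h u - ∫ v, g v ∂(K u) := by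
    have := mul_max_le_integral (φ := fun v => b * h v - g v) ((hh.const_mul b).sub hgc)
      (fun v => sub_nonneg.2 (hu v).2) hLip (fun y z => ?_) (hp u)
    · rwa [integral_sub ((int_h u).const_mul b) (int_g u), integral_const_mul, hK] at this
    · have h1 := abs_le.1 (lip (abs_le.2 ⟨ha.trans hab0, hb⟩) y z)
      have h2 := abs_le.1 (hL y z)
      rw [abs_le]
      constructor <;> nlinarith
  have scale {w : ℝ} (hw : 0 ≤ w) (u : X) : p / H * w * h u ≤ p * w := by
    calc p / H * w * h u ≤ p / H * w * H := by gcongr; exact hH u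
      _ = p * w := by field_simp
  have hs0 : 0 ≤ s := le_max_left _ _
  have ht0 : 0 ≤ t := le_max_left _ _
  have hs : g x - a * h x - (M * Lh + L) * r ≤ s := le_max_right _ _
  have ht : b * h x - g x - (M * Lh + L) * r ≤ t := le_max_right _ _
  have hpH : 0 < p / H := by positivity
  refine ⟨a + p / H * s, b - p / H * t, ?_, ?_, ?_, fun u => ⟨?_, ?_⟩⟩
  · have hq : p * h x / H ≤ 1 := by
      rw [div_le_one hH0]
      nlinarith [hH x, hpos x]
    have h1 : p / H * ((b - a) * h x - 2 * ((M * Lh + L) * r)) ≤ p / H * (s + t) := by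
      gcongr; linarith
    have h2 : (1 - p * h x / H) * (b - a) ≤ (1 - p * h x / H) * δ :=
      mul_le_mul_of_nonneg_left hab (by linarith)
    have h3 : p * h x / H = p / H * h x := by ring
    rw [h3] at h2 ⊢
    nlinarith
  · nlinarith [mul_nonneg hpH.le hs0]
  · nlinarith [mul_nonneg hpH.le ht0]
  · nlinarith [scale hs0 u, lower u]
  · nlinarith [scale ht0 u, upper u]

omit [MetricSpace X] [CompactSpace X] [MeasurableSpace X] [BorelSpace X] in
theorem Trapped.mono {h g : X → ℝ} {M δ δ' : ℝ} (hg : Trapped h M δ g) (hδ : δ ≤ δ') :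
    Trapped h M δ' g := by
  obtain ⟨a, b, hab, hrest⟩ := hg
  exact ⟨a, b, hab.trans hδ, hrest⟩

theorem Trapped.integral_kernel {K : Kernel X X} [IsFiniteKernel K] {h g : X → ℝ} {M δ : ℝ}
    (hg : Trapped h M δ g) (hgc : Continuous g) (hh : Continuous h)
    (hK : ∀ u, ∫ v, h v ∂(K u) = h u) : Trapped h M δ (fun u => ∫ v, g v ∂(K u)) := by
  obtain ⟨a, b, hab, ha, hb, hu⟩ := hg
  refine ⟨a, b, hab, ha, hb, fun u => ⟨?_, ?_⟩⟩
  · rw [← hK u, ← integral_const_mul]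
    exact integral_mono ((integrable_of_continuous hh _).const_mul a)
      (integrable_of_continuous hgc _) fun v => (hu v).1
  · rw [← hK u, ← integral_const_mul]
    exact integral_mono (integrable_of_continuous hgc _)
      ((integrable_of_continuous hh _).const_mul b) fun v => (hu v).2

theorem exists_trapped (K : Kernel X X) [IsFiniteKernel K]
    (hK : ∀ f : X → ℝ, Continuous f → Continuous fun u => ∫ v, f v ∂(K u)) {A : Set X}
    (hAne : A.Nonempty) (hi : CondI K) (hii : CondII K A) (hiv : CondIV K 1) {h : X → ℝ}
    (hpos : ∀ u, 0 < h u) (hlip : IsLip h) (heig : ∀ u, PP K 1 h u = h u) {δ : ℝ} (hδ : 0 < δ) :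
    ∃ M : ℝ, ∃ N : ℕ, ∀ k, N ≤ k → ∀ f : X → ℝ, IsLip f → lipNorm f ≤ 1 →
      Trapped h M δ (PP K k f) := by
  obtain ⟨x, hx⟩ := hAne
  have hh := hlip.continuous
  obtain ⟨Lh, hLh⟩ := hlip
  have hLh' : ∀ u v, |h u - h v| ≤ |Lh| * dist u v := fun u v =>
    (hLh u v).trans (mul_le_mul_of_nonneg_right (le_abs_self _) dist_nonneg)
  obtain ⟨L, hL0, hL⟩ := exists_uniform_lipschitz hi hiv
  obtain ⟨y, -, hy⟩ := isCompact_univ.exists_isMinOn ⟨x, mem_univ x⟩ hh.continuousOn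
  obtain ⟨z, -, hz⟩ := isCompact_univ.exists_isMaxOn ⟨x, mem_univ x⟩ hh.continuousOn
  have hmin : ∀ u, h y ≤ h u := fun u => hy (mem_univ u)
  have hmax : ∀ u, h u ≤ h z := fun u => hz (mem_univ u)
  set M := (h y)⁻¹ with hMdef
  have hM : 0 < M := inv_pos.2 (hpos y)
  have hinv (k : ℕ) (u : X) : ∫ v, h v ∂((K ^ k) u) = h u := by
    have := congrFun (PP_eq_self K hh heig k) u
    rwa [PP, iterP_eq_pow] at this
  have shift {k n : ℕ} {f : X → ℝ} (hf : Continuous f) {η : ℝ} (ht : Trapped h M η (PP K k f)) :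
      Trapped h M η (PP K (k + n) f) := by
    have := isFiniteKernel_pow K n
    rw [funext (PP_add K k n hf)]
    exact ht.integral_kernel (PP_continuous K hK k hf) hh (hinv n)
  set R := M * |Lh| + L + 1 with hR
  have hRpos : 0 < R := by positivity
  obtain ⟨m, -, p', hp', hirr⟩ := hii (δ * h x / (4 * R)) (by have := hpos x; positivity)
  set r := δ * h x / (4 * R) with hr
  set p := min p' 1
  have hp0 : 0 < p := lt_min hp' one_pos
  have hp1 : p ≤ 1 := min_le_right _ _
  have := isFiniteKernel_pow K m
  have hball (u : X) : p ≤ ((K ^ m) u).real (closedBall x r) := by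
    have h1 := hirr u x hx
    rw [iterP_eq_pow] at h1
    exact (min_le_left _ _).trans ((ENNReal.ofReal_le_iff_le_toReal (measure_ne_top _ _)).1 h1)
  set q := p * h x / h z with hq
  have hq0 : 0 < q := by have := hpos x; have := hpos z; positivity
  have hq1 : q ≤ 1 := by
    rw [hq, div_le_one (hpos z)]
    nlinarith [hmax x, hpos x]
  have hrest : 2 * (p / h z) * ((M * |Lh| + L) * r) ≤ q * (δ / 2) := by
    have hr0 : 0 < r := by have := hpos x; positivity
    have h1 : (M * |Lh| + L) * r ≤ δ * h x / 4 := by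
      calc (M * |Lh| + L) * r ≤ R * r := by gcongr; linarith
        _ = δ * h x / 4 := by rw [hr]; field_simp
    calc 2 * (p / h z) * ((M * |Lh| + L) * r) ≤ 2 * (p / h z) * (δ * h x / 4) := by
          have := hpos z; gcongr
      _ = q * (δ / 2) := by rw [hq]; ring
  have iter (n : ℕ) {f : X → ℝ} (hf : IsLip f) (hf1 : lipNorm f ≤ 1) :
      Trapped h M (δ / 2 + (1 - q) ^ n * (2 * M)) (PP K (1 + n * m) f) := by
    have hfc := hf.continuous
    induction n with
    | zero =>
      refine Trapped.mono (δ := 2 * M) ?_ (by simp; linarith)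
      refine shift (k := 0) (n := 1 + 0 * m) hfc ?_ |> fun ht => by simpa using ht
      rw [PP_zero K f hfc]
      refine ⟨-M, M, by linarith, le_rfl, le_rfl, fun u => ?_⟩
      have h1 := abs_le.1 ((abs_le_supX hfc u).trans ((supX_le_lipNorm f).trans hf1))
      have h2 : 1 ≤ M * h u := by
        calc 1 = M * h y := (inv_mul_cancel₀ (hpos y).ne').symm
          _ ≤ M * h u := mul_le_mul_of_nonneg_left (hmin u) hM.le
      constructor <;> linarith
    | succ n ih =>
      have hstep := ih.contract (K := K ^ m) (PP_continuous K hK _ hfc) hh hpos hmax (hinv m) hL0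
        (abs_nonneg Lh) hM.le (hL _ (by omega) f hf hf1) hLh' hp0 hp1 hball
      rw [show 1 + (n + 1) * m = 1 + n * m + m by ring, funext (PP_add K (1 + n * m) m hfc)]
      refine hstep.mono ?_
      rw [← hq, pow_succ]
      linarith
  obtain ⟨n, hn⟩ := exists_pow_lt_of_lt_one (show 0 < δ / 2 / (2 * M) by positivity)
    (show 1 - q < 1 by linarith)
  refine ⟨M, 1 + n * m, fun k hk f hf hf1 => ?_⟩
  obtain ⟨j, rfl⟩ := Nat.exists_eq_add_of_le hk
  refine shift hf.continuous ((iter n hf hf1).mono ?_)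
  rw [lt_div_iff₀ (by positivity)] at hn
  linarith

theorem stmt_6
    {X : Type} [MetricSpace X] [CompactSpace X] [MeasurableSpace X] [BorelSpace X]
    (P : X → Measure X) (A : Set X) (hA : IsClosed A)
    (hker : GenKernel P) (hPA : ∀ u ∈ A, P u Aᶜ = 0)
    (hi : CondI P) (hii : CondII P A)
    (hiii : CondIII P A) (hiv : CondIV P 1)
    (μ : Measure X) (hμ : IsProbabilityMeasure μ) (hsupp : msupp μ = A)
    (hstat : PPstar P 1 μ = μ)
    (h : X → ℝ) (hpos : ∀ u : X, 0 < h u) (hlip : IsLip h)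
    (heig : ∀ u : X, PP P 1 h u = h u) (hnorm : ∫ u, h u ∂μ = 1) :
    ∀ ε : ℝ, 0 < ε → ∃ N : ℕ, ∀ k : ℕ, N ≤ k →
      ∀ ν : Measure X, IsProbabilityMeasure ν →
        ∀ f : X → ℝ, IsLip f → lipNorm f ≤ 1 →
          |(∫ v, f v ∂(PPstar P k ν)) - (∫ u, h u ∂ν) * ∫ v, f v ∂μ| ≤ ε := by
  intro ε hε
  have hcont := hker.2.2.2
  obtain ⟨K, hfin, rfl⟩ := hker.exists_isFiniteKernel
  have hAne : A.Nonempty := hsupp ▸ nonempty_msupp μ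
  have hh := hlip.continuous
  obtain ⟨x, hx⟩ := hAne
  obtain ⟨z, -, hz⟩ := isCompact_univ.exists_isMaxOn ⟨x, mem_univ x⟩ hh.continuousOn
  have hz0 := hpos z
  obtain ⟨M, N, hN⟩ := exists_trapped K hcont ⟨x, hx⟩ hi hii hiv hpos hlip heig
    (δ := ε / h z) (by positivity)
  refine ⟨N, fun k hk ν hν f hf hf1 => ?_⟩
  have hfc := hf.continuous
  rw [integral_PPstar K k ν hfc]
  have := (hN k hk f hf hf1).integral (ρ := ν) hh (PP_continuous K hcont k hfc) hnorm
    (integral_PP_of_stationary K hcont hstat k hfc) (by positivity) hpos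
    (fun u => hz (mem_univ u))
  rwa [div_mul_cancel₀ _ hz0.ne'] at this

end GMK
end
end

section
/- Let (X,d) be a compact metric space with diam(X) = sup_{u,v∈X} d(u,v) > 0. For any θ ≥ (diam(X))^{−1} and any two Borel probability measures σ₁, σ₂ on X one has (1+θ)^{−1} ‖σ₁ − σ₂‖_{K_θ} ≤ ‖σ₁ − σ₂‖_L^* ≤ diam(X) · ‖σ₁ − σ₂‖_{K_θ}. -/
open MeasureTheory Filter Set Metric

noncomputable section

namespace GMK8

variable {X : Type} [MetricSpace X] [CompactSpace X] [MeasurableSpace X] [BorelSpace X]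

/-- The Kantorovich distance associated with the metric `d_θ(u,v) = min 1 (θ d(u,v))`:
the supremum of `|⟨f,σ₁⟩ - ⟨f,σ₂⟩|` over functions with `L_θ(f) ≤ 1`. -/
def Kdist (θ : ℝ) (σ₁ σ₂ : Measure X) : ℝ :=
  sSup {r : ℝ | ∃ f : X → ℝ, (∀ u v : X, |f u - f v| ≤ min 1 (θ * dist u v)) ∧
    r = |(∫ u, f u ∂σ₁) - ∫ u, f u ∂σ₂|}

/-- The dual-Lipschitz distance: the supremum of `|⟨f,σ₁⟩ - ⟨f,σ₂⟩|` over functions with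
`‖f‖_∞ + L(f) ≤ 1`. -/
def Ldist (σ₁ σ₂ : Measure X) : ℝ :=
  sSup {r : ℝ | ∃ f : X → ℝ, ∃ a L : ℝ, (∀ u : X, |f u| ≤ a) ∧
    (∀ u v : X, |f u - f v| ≤ L * dist u v) ∧ a + L ≤ 1 ∧
    r = |(∫ u, f u ∂σ₁) - ∫ u, f u ∂σ₂|}

/-- On a space of positive diameter a Lipschitz constant is nonnegative. -/
theorem lipschitz_const_nonneg {X : Type*} [MetricSpace X]
    (hdiam : 0 < Metric.diam (Set.univ : Set X)) {f : X → ℝ} {L : ℝ}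
    (hf : ∀ u v : X, |f u - f v| ≤ L * dist u v) : 0 ≤ L := by
  obtain ⟨u, v, huv⟩ : ∃ u v : X, u ≠ v := by
    by_contra! h
    exact hdiam.ne' (Metric.diam_subsingleton fun u _ v _ => h u v)
  exact nonneg_of_mul_nonneg_left ((abs_nonneg _).trans (hf u v)) (dist_pos.2 huv)

theorem abs_integral_sub_integral_le {X : Type*} [MeasurableSpace X]
    (σ₁ σ₂ : Measure X) [IsProbabilityMeasure σ₁]
    [IsProbabilityMeasure σ₂] {f : X → ℝ} {a : ℝ} (hf : ∀ u, |f u| ≤ a) :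
    |(∫ u, f u ∂σ₁) - ∫ u, f u ∂σ₂| ≤ 2 * a := by
  have key (σ : Measure X) [IsProbabilityMeasure σ] : |∫ u, f u ∂σ| ≤ a := by
    simpa using norm_integral_le_of_norm_le_const (μ := σ) (f := f) (C := a)
      (Eventually.of_forall hf)
  linarith [abs_sub (∫ u, f u ∂σ₁) (∫ u, f u ∂σ₂), key σ₁, key σ₂]

theorem integrable_of_abs_sub_le {f : X → ℝ} {L : ℝ}
    (hf : ∀ u v : X, |f u - f v| ≤ L * dist u v) (σ : Measure X) [IsFiniteMeasure σ] :
    Integrable f σ := by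
  have hc : Continuous f := (LipschitzWith.of_dist_le' hf).continuous
  exact hc.integrable_of_hasCompactSupport (HasCompactSupport.of_compactSpace f)

theorem integral_sub_integral_sub_const {X : Type*} [MeasurableSpace X]
    (σ₁ σ₂ : Measure X) [IsProbabilityMeasure σ₁]
    [IsProbabilityMeasure σ₂] {f : X → ℝ} (hf₁ : Integrable f σ₁) (hf₂ : Integrable f σ₂) (c : ℝ) :
    (∫ u, (f u - c) ∂σ₁) - ∫ u, (f u - c) ∂σ₂ = (∫ u, f u ∂σ₁) - ∫ u, f u ∂σ₂ := by
  rw [integral_sub hf₁ (integrable_const c), integral_sub hf₂ (integrable_const c)]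
  simp

theorem abs_integral_const_mul_sub {X : Type*} [MeasurableSpace X]
    (σ₁ σ₂ : Measure X) (f : X → ℝ) {c : ℝ} (hc : 0 ≤ c) :
    |(∫ u, c * f u ∂σ₁) - ∫ u, c * f u ∂σ₂| = c * |(∫ u, f u ∂σ₁) - ∫ u, f u ∂σ₂| := by
  rw [integral_const_mul, integral_const_mul, ← mul_sub, abs_mul, abs_of_nonneg hc]

/-- The integral gaps of functions with `L_θ(f) ≤ 1` are at most `2`. -/
theorem abs_integral_sub_le_two [Nonempty X] {θ : ℝ} (σ₁ σ₂ : Measure X) [IsProbabilityMeasure σ₁]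
    [IsProbabilityMeasure σ₂] {f : X → ℝ}
    (hf : ∀ u v : X, |f u - f v| ≤ min 1 (θ * dist u v)) :
    |(∫ u, f u ∂σ₁) - ∫ u, f u ∂σ₂| ≤ 2 := by
  obtain ⟨x₀⟩ := ‹Nonempty X›
  have hL (u v : X) := (hf u v).trans (min_le_right _ _)
  rw [← integral_sub_integral_sub_const σ₁ σ₂ (integrable_of_abs_sub_le hL σ₁)
    (integrable_of_abs_sub_le hL σ₂) (f x₀)]
  simpa using abs_integral_sub_integral_le σ₁ σ₂ (fun u => (hf u x₀).trans (min_le_left _ _))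

theorem le_Ldist {X : Type} [MetricSpace X] [MeasurableSpace X]
    (σ₁ σ₂ : Measure X) [IsProbabilityMeasure σ₁] [IsProbabilityMeasure σ₂]
    (hdiam : 0 < Metric.diam (Set.univ : Set X)) {f : X → ℝ} {a L : ℝ} (ha : ∀ u : X, |f u| ≤ a)
    (hL : ∀ u v : X, |f u - f v| ≤ L * dist u v) (haL : a + L ≤ 1) :
    |(∫ u, f u ∂σ₁) - ∫ u, f u ∂σ₂| ≤ Ldist σ₁ σ₂ := by
  refine le_csSup ⟨2, ?_⟩ ⟨f, a, L, ha, hL, haL, rfl⟩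
  rintro _ ⟨g, b, M, hb, hM, hbM, rfl⟩
  linarith [abs_integral_sub_integral_le σ₁ σ₂ hb, lipschitz_const_nonneg hdiam hM]

theorem stmt_8 {X : Type} [MetricSpace X] [CompactSpace X] [MeasurableSpace X] [BorelSpace X]
    (hdiam : 0 < Metric.diam (Set.univ : Set X))
    (θ : ℝ) (hθ : (Metric.diam (Set.univ : Set X))⁻¹ ≤ θ)
    (σ₁ σ₂ : Measure X) (h₁ : IsProbabilityMeasure σ₁) (h₂ : IsProbabilityMeasure σ₂) :
    (1 + θ)⁻¹ * Kdist θ σ₁ σ₂ ≤ Ldist σ₁ σ₂ ∧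
    Ldist σ₁ σ₂ ≤ Metric.diam (Set.univ : Set X) * Kdist θ σ₁ σ₂ := by
  have hθ0 : 0 < θ := (inv_pos.2 hdiam).trans_le hθ
  have : Nonempty X := by
    by_contra h
    rw [not_nonempty_iff] at h
    simp [Set.univ_eq_empty_iff.2 h] at hdiam
  obtain ⟨x₀⟩ := ‹Nonempty X›
  constructor
  · rw [inv_mul_le_iff₀ (by positivity)]
    refine csSup_le ⟨_, 0, fun u v => ?_, rfl⟩ ?_
    · simp only [Pi.zero_apply, sub_zero, abs_zero]
      positivity
    rintro _ ⟨f, hf, rfl⟩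
    have hL (u v : X) := (hf u v).trans (min_le_right _ _)
    have hc : 0 ≤ (1 + θ)⁻¹ := by positivity
    rw [← inv_mul_le_iff₀ (by positivity),
      ← integral_sub_integral_sub_const σ₁ σ₂ (integrable_of_abs_sub_le hL σ₁)
      (integrable_of_abs_sub_le hL σ₂) (f x₀), ← abs_integral_const_mul_sub _ _ _ hc]
    refine le_Ldist σ₁ σ₂ hdiam (a := (1 + θ)⁻¹ * 1) (L := (1 + θ)⁻¹ * θ)
      (fun u => ?_) (fun u v => ?_) ?_
    · rw [abs_mul, abs_of_nonneg hc]
      exact mul_le_mul_of_nonneg_left ((hf u x₀).trans (min_le_left _ _)) hc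
    · rw [← mul_sub, abs_mul, abs_of_nonneg hc, sub_sub_sub_cancel_right, mul_assoc]
      exact mul_le_mul_of_nonneg_left (hL u v) hc
    · rw [← mul_add, inv_mul_cancel₀ (by positivity)]
  · refine csSup_le ⟨_, 0, 0, 0, by simp, by simp, by simp, rfl⟩ ?_
    rintro _ ⟨f, a, L, ha, hL, haL, rfl⟩
    have hc : 0 ≤ (Metric.diam (Set.univ : Set X))⁻¹ := by positivity
    have hL1 : L ≤ 1 := by linarith [(abs_nonneg _).trans (ha x₀)]
    have hd (u v : X) : |f u - f v| ≤ dist u v :=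
      (hL u v).trans (mul_le_of_le_one_left dist_nonneg hL1)
    rw [← inv_mul_le_iff₀ hdiam, ← abs_integral_const_mul_sub _ _ _ hc]
    refine le_csSup ⟨2, ?_⟩ ⟨_, fun u v => ?_, rfl⟩
    · rintro _ ⟨g, hg, rfl⟩
      have : Nonempty X := ⟨x₀⟩
      exact abs_integral_sub_le_two σ₁ σ₂ hg
    · rw [← mul_sub, abs_mul, abs_of_nonneg hc]
      refine le_min ?_ (mul_le_mul hθ (hd u v) (abs_nonneg _) hθ0.le)
      rw [inv_mul_le_iff₀ hdiam, mul_one]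
      exact (hd u v).trans (Metric.dist_le_diam_of_mem isCompact_univ.isBounded
        (Set.mem_univ u) (Set.mem_univ v))

end GMK8
end
end
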